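/- arXiv:2411.09028 — 6 statements merged into one kernel-verified Lean document; each statement's English description precedes it below -/
import Mathlib

section
/- Let n be an odd prime and let 1 ≤ a_1 < a_2 < n/2 be integers with n ∤ (a_1² + a_2²). Let λ_j = 2 cos(2π a_1 j / n) + 2 cos(2π a_2 j / n) for j = 0,...,n-1 be the eigenvalues of A(C_n(a_1, a_2)). If j, k ∈ {1,...,n-1} with j ≠ k and λ_j = λ_k, then j + k = n. -/
open scoped Real

/-- For `p` prime, a rational linear relation among the `p`-th roots of unity has constant
coefficients. -/
theorem ZMod.coeff_eq_of_sum_mul_stdAddChar_eq_zero {p : ℕ} [Fact p.Prime] (c : ZMod p → ℚ)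
    (h : ∑ x, (c x : ℂ) * ZMod.stdAddChar x = 0) (x y : ZMod p) : c x = c y := by
  have hp : p.Prime := Fact.out
  let q : Polynomial ℚ := ∑ i ∈ Finset.range p, Polynomial.monomial i (c i)
  have hcoeff (x : ZMod p) : q.coeff x.val = c x := by
    simp [q, Polynomial.finsetSum_coeff, Polynomial.coeff_monomial, ZMod.val_lt]
  set ζ : ℂ := ZMod.stdAddChar (1 : ZMod p) with hζdef
  have hζ : IsPrimitiveRoot ζ p := by
    have h1 := Complex.isPrimitiveRoot_exp p hp.ne_zero
    have h2 := ZMod.stdAddChar_coe (N := p) 1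
    simp only [Int.cast_one, mul_one] at h2
    rwa [hζdef, h2]
  have hpow (i : ℕ) : (ZMod.stdAddChar (i : ZMod p) : ℂ) = ζ ^ i := by
    rw [hζdef, ← AddChar.map_nsmul_eq_pow, nsmul_one]
  have hq : Polynomial.aeval ζ q = 0 := by
    rw [← h]
    simp only [q, map_sum, Polynomial.aeval_monomial]
    refine Finset.sum_bij' (fun i _ => (i : ZMod p)) (fun x _ => x.val) (by simp)
      (by simp [ZMod.val_lt]) ?_ (by simp) ?_
    · intro i hi
      exact ZMod.val_cast_of_lt (Finset.mem_range.mp hi)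
    · intro i _
      rw [hpow]
      simp
  have hdvd : Polynomial.cyclotomic p ℚ ∣ q := by
    rw [Polynomial.cyclotomic_eq_minpoly_rat hζ hp.pos]
    exact minpoly.dvd ℚ ζ hq
  obtain ⟨r, hr⟩ := hdvd
  have hconst : r.natDegree = 0 := by
    by_cases hr0 : r = 0
    · simp [hr0]
    have hdeg : q.natDegree ≤ p - 1 := by
      refine Polynomial.natDegree_sum_le_of_forall_le _ _ fun i hi => ?_
      have := Finset.mem_range.mp hi
      exact (Polynomial.natDegree_monomial_le _).trans (by omega)
    rw [hr, Polynomial.natDegree_mul (Polynomial.cyclotomic_ne_zero p ℚ) hr0,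
      Polynomial.natDegree_cyclotomic, Nat.totient_prime hp] at hdeg
    omega
  obtain ⟨a, rfl⟩ := Polynomial.natDegree_eq_zero.mp hconst
  have hall (x : ZMod p) : c x = a := by
    rw [← hcoeff, hr, Polynomial.coeff_mul_C, Polynomial.cyclotomic_prime]
    simp [Polynomial.finsetSum_coeff, Polynomial.coeff_X_pow, ZMod.val_lt]
  rw [hall, hall]

theorem ZMod.stdAddChar_add_stdAddChar_neg {n : ℕ} [NeZero n] (a j : ℕ) :
    (ZMod.stdAddChar ((a : ZMod n) * (j : ZMod n)) +
        ZMod.stdAddChar (-((a : ZMod n) * (j : ZMod n))) : ℂ) =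
      ((2 * Real.cos (2 * π * a * j / n) : ℝ) : ℂ) := by
  have h1 := ZMod.stdAddChar_coe (N := n) (a * j)
  have h2 := ZMod.stdAddChar_coe (N := n) (-(a * j))
  push_cast at h1 h2 ⊢
  rw [h1, h2, Complex.two_cos]
  congr 2 <;> ring

/-- For `p` prime, a multiset of nonzero residues mod `p` is determined by the sum of the
corresponding `p`-th roots of unity. -/
theorem ZMod.multiset_eq_of_sum_stdAddChar_eq {p : ℕ} [Fact p.Prime] {s t : Multiset (ZMod p)}
    (hs : 0 ∉ s) (ht : 0 ∉ t)
    (h : (s.map fun x => (ZMod.stdAddChar x : ℂ)).sum =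
      (t.map fun x => (ZMod.stdAddChar x : ℂ)).sum) : s = t := by
  have key (u : Multiset (ZMod p)) : (u.map fun x => (ZMod.stdAddChar x : ℂ)).sum =
      ∑ x, (u.count x : ℂ) * ZMod.stdAddChar x := by
    rw [Finset.sum_multiset_map_count]
    simp only [nsmul_eq_mul]
    refine Finset.sum_subset (Finset.subset_univ _) fun x _ hx => ?_
    simp [Multiset.count_eq_zero.mpr (by simpa using hx)]
  ext x
  have h0 := ZMod.coeff_eq_of_sum_mul_stdAddChar_eq_zero
    (fun x => (s.count x : ℚ) - t.count x) (by
      push_cast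
      simp only [sub_mul, Finset.sum_sub_distrib]
      rw [← key, ← key, h, sub_self]) x 0
  simp only [Multiset.count_eq_zero.mpr hs, Multiset.count_eq_zero.mpr ht, sub_self,
    sub_eq_zero] at h0
  exact_mod_cast h0

theorem statement3 (n a1 a2 : ℕ) (hp : n.Prime) (hodd : Odd n)
    (h1 : 1 ≤ a1) (h12 : a1 < a2) (h2 : 2 * a2 < n)
    (hnd : ¬ (n ∣ a1 ^ 2 + a2 ^ 2))
    (j k : ℕ) (hj1 : 1 ≤ j) (hjn : j ≤ n - 1) (hk1 : 1 ≤ k) (hkn : k ≤ n - 1)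
    (hjk : j ≠ k)
    (heig : 2 * Real.cos (2 * π * a1 * j / n) + 2 * Real.cos (2 * π * a2 * j / n)
          = 2 * Real.cos (2 * π * a1 * k / n) + 2 * Real.cos (2 * π * a2 * k / n)) :
    j + k = n := by
  have : Fact n.Prime := ⟨hp⟩
  have hne (m : ℕ) (hm : 0 < m) (hmn : m < n) : (m : ZMod n) ≠ 0 := fun h =>
    absurd (Nat.le_of_dvd hm ((ZMod.natCast_eq_zero_iff m n).mp h)) (by omega)
  have hA1 := hne a1 (by omega) (by omega)
  have hA2 := hne a2 (by omega) (by omega)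
  have hJ := hne j (by omega) (by omega)
  have hK := hne k (by omega) (by omega)
  have hadd : (a1 : ZMod n) + a2 ≠ 0 := by
    exact_mod_cast hne (a1 + a2) (by omega) (by omega)
  have hsub : (a2 : ZMod n) - a1 ≠ 0 := by
    rw [← Nat.cast_sub h12.le]
    exact hne (a2 - a1) (by omega) (by omega)
  have hsq : (a1 : ZMod n) ^ 2 + a2 ^ 2 ≠ 0 := by
    intro h
    exact hnd ((ZMod.natCast_eq_zero_iff _ n).mp (by exact_mod_cast h))
  have hJK : (j : ZMod n) - k ≠ 0 := by
    intro h
    have h' := (ZMod.natCast_eq_natCast_iff' j k n).mp (sub_eq_zero.mp h)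
    rw [Nat.mod_eq_of_lt (by omega), Nat.mod_eq_of_lt (by omega)] at h'
    exact hjk h'
  let S (i : ℕ) : Multiset (ZMod n) := {(a1 : ZMod n) * i, -((a1 : ZMod n) * i), (a2 : ZMod n) * i,
    -((a2 : ZMod n) * i)}
  have hS : S j = S k := by
    refine ZMod.multiset_eq_of_sum_stdAddChar_eq (by simp [S, hA1, hA2, hJ]) (by simp [S, hA1, hA2, hK]) ?_
    have e (i : ℕ) : ((S i).map fun x => (ZMod.stdAddChar x : ℂ)).sum =
        ((2 * Real.cos (2 * π * a1 * i / n) + 2 * Real.cos (2 * π * a2 * i / n) : ℝ) : ℂ) := by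
      rw [Complex.ofReal_add, ← ZMod.stdAddChar_add_stdAddChar_neg,
        ← ZMod.stdAddChar_add_stdAddChar_neg]
      simp [S, add_assoc]
    rw [e, e, heig]
  have m1 : (a1 : ZMod n) * j ∈ S k := hS ▸ by simp [S]
  have m2 : (a2 : ZMod n) * j ∈ S k := hS ▸ by simp [S]
  simp only [S, Multiset.insert_eq_cons, Multiset.mem_cons, Multiset.mem_singleton] at m1 m2
  have hsum : (j : ZMod n) + k = 0 := by
    have same (a : ZMod n) (ha : a ≠ 0) (h : a * j = a * k ∨ a * j = -(a * k)) :
        (j : ZMod n) + k = 0 := by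
      rcases h with h | h
      · exact absurd (mul_left_cancel₀ ha h) (sub_ne_zero.mp hJK)
      · exact (mul_eq_zero.mp (by linear_combination h : a * ((j : ZMod n) + k) = 0)).resolve_left ha
    have sqsub : (k : ZMod n) * ((a1 + a2) * (a2 - a1)) ≠ 0 :=
      mul_ne_zero hK (mul_ne_zero hadd hsub)
    have sqadd : (k : ZMod n) * (a1 ^ 2 + a2 ^ 2) ≠ 0 := mul_ne_zero hK hsq
    rcases m1 with m1 | m1 | m1 | m1
    · exact same _ hA1 (.inl m1)
    · exact same _ hA1 (.inr m1)
    all_goals rcases m2 with m2 | m2 | m2 | m2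
    · exact absurd (by linear_combination a1 * m2 - a2 * m1) sqsub
    · exact absurd (by linear_combination a1 * m2 - a2 * m1) sqadd
    · exact same _ hA2 (.inl m2)
    · exact same _ hA2 (.inr m2)
    · exact absurd (by linear_combination a2 * m1 - a1 * m2) sqadd
    · exact absurd (by linear_combination a2 * m1 - a1 * m2) sqsub
    · exact same _ hA2 (.inl m2)
    · exact same _ hA2 (.inr m2)
  have hdvd : n ∣ j + k := (ZMod.natCast_eq_zero_iff _ n).mp (by exact_mod_cast hsum)
  obtain ⟨m, hm⟩ := hdvd
  have hm2 : m < 2 := by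
    by_contra! h
    have := Nat.mul_le_mul_left n h
    omega
  interval_cases m <;> omega
end

section
/- Let n be an odd prime and let 1 ≤ a_1 < a_2 < n/2 be integers with n | (a_1² + a_2²). Let λ_j = 2 cos(2π a_1 j / n) + 2 cos(2π a_2 j / n) for j = 0,...,n-1 be the eigenvalues of A(C_n(a_1, a_2)). Then for j, k ∈ {0,...,n-1} with j ≠ k, one has λ_j = λ_k if and only if n | (j + k) or n | (j² + k²). -/
open scoped Real

open Polynomial in
/-- A rational polynomial of degree less than a prime `p` that vanishes at `1` and at a primitive
`p`-th root of unity is zero. -/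
theorem IsPrimitiveRoot.eq_zero_of_aeval_eq_zero {p : ℕ} (hp : p.Prime) {ζ : ℂ}
    (hζ : IsPrimitiveRoot ζ p) {P : ℚ[X]} (hdeg : P.degree < p) (h1 : P.eval 1 = 0)
    (hP : aeval ζ P = 0) : P = 0 := by
  have hΦ : cyclotomic p ℚ ∣ P := by
    rw [cyclotomic_eq_minpoly_rat hζ hp.pos]
    exact minpoly.dvd ℚ ζ hP
  have hX : cyclotomic 1 ℚ ∣ P := by
    rw [cyclotomic_one]
    simpa using dvd_iff_isRoot.mpr h1
  have hdvd := (cyclotomic.isCoprime_rat hp.ne_one).mul_dvd hΦ hX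
  have : Fact p.Prime := ⟨hp⟩
  rw [cyclotomic_one, cyclotomic_prime_mul_X_sub_one] at hdvd
  refine eq_zero_of_dvd_of_degree_lt hdvd ?_
  rwa [← C_1, degree_X_pow_sub_C hp.pos]

open Polynomial in
/-- Two equinumerous multisets of powers of a primitive `p`-th root of unity, `p` prime, with the
same sum have the same exponents modulo `p`. -/
theorem IsPrimitiveRoot.map_mod_eq_of_sum_pow_eq {p : ℕ} (hp : p.Prime) {ζ : ℂ}
    (hζ : IsPrimitiveRoot ζ p) {M N : Multiset ℕ} (hcard : M.card = N.card)
    (hsum : (M.map (ζ ^ ·)).sum = (N.map (ζ ^ ·)).sum) :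
    M.map (· % p) = N.map (· % p) := by
  let F : Multiset ℕ → ℚ[X] := fun S => (S.map fun m => X ^ (m % p)).sum
  have hF_eval (S : Multiset ℕ) : (F S).eval 1 = S.card := by
    induction S using Multiset.induction with
    | empty => simp [F]
    | cons a S ih => simp_all [F, add_comm]
  have hF_aeval (S : Multiset ℕ) : aeval ζ (F S) = (S.map (ζ ^ ·)).sum := by
    have hmod (m : ℕ) : ζ ^ (m % p) = ζ ^ m := by
      rw [hζ.eq_orderOf, pow_mod_orderOf]
    induction S using Multiset.induction with
    | empty => simp [F]
    | cons a S ih => simp_all [F]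
  have hF_degree (S : Multiset ℕ) : (F S).degree < p := by
    induction S using Multiset.induction with
    | empty => simp [F]
    | cons a S ih =>
      simp only [F, Multiset.map_cons, Multiset.sum_cons]
      refine (degree_add_le _ _).trans_lt (max_lt ?_ ih)
      rw [degree_X_pow]
      exact_mod_cast Nat.mod_lt a hp.pos
  have hF_coeff (S : Multiset ℕ) (e : ℕ) : (F S).coeff e = (S.map (· % p)).count e := by
    induction S using Multiset.induction with
    | empty => simp [F]
    | cons a S ih =>
      simp only [F, Multiset.map_cons, Multiset.sum_cons, coeff_add, coeff_X_pow,
        Multiset.count_cons] at ih ⊢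
      rw [ih]
      push_cast
      ring
  have hzero : F M - F N = 0 := by
    refine hζ.eq_zero_of_aeval_eq_zero hp ?_ ?_ ?_
    · exact (degree_sub_le _ _).trans_lt (max_lt (hF_degree M) (hF_degree N))
    · rw [eval_sub, hF_eval, hF_eval, hcard, sub_self]
    · rw [map_sub, hF_aeval, hF_aeval, hsum, sub_self]
  ext e
  have := hF_coeff M e
  rw [sub_eq_zero.mp hzero, hF_coeff N e] at this
  exact_mod_cast this.symm

theorem Complex.two_mul_cos_eq_pow_add_pow {n : ℕ} (hn : n ≠ 0) (m : ℕ) :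
    ((2 * Real.cos (2 * π * m / n) : ℝ) : ℂ) =
      Complex.exp (2 * π * Complex.I / n) ^ m +
        Complex.exp (2 * π * Complex.I / n) ^ ((n - 1) * m) := by
  have hζ := Complex.isPrimitiveRoot_exp n hn
  have hinv : Complex.exp (2 * π * Complex.I / n) ^ ((n - 1) * m) =
      (Complex.exp (2 * π * Complex.I / n) ^ m)⁻¹ := by
    refine eq_inv_of_mul_eq_one_left ?_
    rw [← pow_add, ← Nat.succ_mul, Nat.succ_eq_add_one,
      Nat.sub_add_cancel (Nat.one_le_iff_ne_zero.mpr hn), pow_mul, hζ.pow_eq_one, one_pow]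
  rw [hinv, ← Complex.exp_nat_mul, ← Complex.exp_neg]
  push_cast
  rw [Complex.two_cos]
  congr 2 <;> ring

theorem Real.cos_two_pi_mul_div_eq_of_sq_eq {n : ℕ} (hn : n.Prime) {x y : ℕ}
    (h : (x : ZMod n) ^ 2 = (y : ZMod n) ^ 2) :
    Real.cos (2 * π * x / n) = Real.cos (2 * π * y / n) := by
  have : Fact n.Prime := ⟨hn⟩
  have hn0 : (n : ℝ) ≠ 0 := by exact_mod_cast hn.ne_zero
  rw [Real.cos_eq_cos_iff]
  rcases sq_eq_sq_iff_eq_or_eq_neg.mp h with h | h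
  · have h' : ((y - x : ℤ) : ZMod n) = 0 := by push_cast; rw [h, sub_self]
    obtain ⟨c, hc⟩ := (ZMod.intCast_zmod_eq_zero_iff_dvd _ n).mp h'
    have hc' : (y : ℝ) - x = n * c := by exact_mod_cast hc
    refine ⟨c, Or.inl ?_⟩
    rw [eq_add_of_sub_eq hc']
    field_simp
  · have h' : ((y + x : ℤ) : ZMod n) = 0 := by push_cast; rw [h, add_neg_cancel]
    obtain ⟨c, hc⟩ := (ZMod.intCast_zmod_eq_zero_iff_dvd _ n).mp h'
    have hc' : (y : ℝ) + x = n * c := by exact_mod_cast hc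
    refine ⟨c, Or.inr ?_⟩
    rw [eq_sub_of_add_eq hc']
    field_simp

theorem statement4 (n a1 a2 : ℕ) (hp : n.Prime) (hodd : Odd n)
    (h1 : 1 ≤ a1) (h12 : a1 < a2) (h2 : 2 * a2 < n)
    (hd : n ∣ a1 ^ 2 + a2 ^ 2)
    (j k : ℕ) (hjn : j < n) (hkn : k < n) (hjk : j ≠ k) :
    (2 * Real.cos (2 * π * a1 * j / n) + 2 * Real.cos (2 * π * a2 * j / n)
      = 2 * Real.cos (2 * π * a1 * k / n) + 2 * Real.cos (2 * π * a2 * k / n))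
    ↔ (n ∣ j + k ∨ n ∣ j ^ 2 + k ^ 2) := by
  have : Fact n.Prime := ⟨hp⟩
  have hcast (a m : ℕ) : 2 * π * a * m / n = 2 * π * ((a * m : ℕ) : ℝ) / n := by
    push_cast; ring
  have hdvd (x : ℕ) : n ∣ x ↔ (x : ZMod n) = 0 := (ZMod.natCast_eq_zero_iff x n).symm
  rw [hdvd] at hd
  rw [hdvd, hdvd]
  push_cast at hd ⊢
  have ha : (a1 : ZMod n) ≠ 0 := by
    rw [Ne, ← hdvd]
    exact Nat.not_dvd_of_pos_of_lt h1 (by omega)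
  have hjk' : (j : ZMod n) ≠ k := fun h => hjk <| by
    rwa [ZMod.natCast_eq_natCast_iff', Nat.mod_eq_of_lt hjn, Nat.mod_eq_of_lt hkn] at h
  simp only [hcast]
  constructor
  · intro h
    have hζ := Complex.isPrimitiveRoot_exp n hp.ne_zero
    have hmulti := hζ.map_mod_eq_of_sum_pow_eq hp
      (M := {a1 * j, (n - 1) * (a1 * j), a2 * j, (n - 1) * (a2 * j)})
      (N := {a1 * k, (n - 1) * (a1 * k), a2 * k, (n - 1) * (a2 * k)}) (by simp) (by
        have h' := congrArg (fun x : ℝ => (x : ℂ)) h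
        simp only [Complex.ofReal_add _ _, Complex.two_mul_cos_eq_pow_add_pow hp.ne_zero] at h'
        simpa [add_assoc] using h')
    have hmem : a1 * j % n ∈ Multiset.map (· % n)
        {a1 * k, (n - 1) * (a1 * k), a2 * k, (n - 1) * (a2 * k)} := by
      rw [← hmulti]
      exact Multiset.mem_map_of_mem _ (by simp)
    obtain ⟨m, hm, hmn⟩ := Multiset.mem_map.mp hmem
    have hmn' : (m : ZMod n) = a1 * j := by
      rw [← Nat.cast_mul]
      exact (ZMod.natCast_eq_natCast_iff' _ _ _).mpr hmn
    have hsq : (a1 * j : ZMod n) ^ 2 = (a1 * k) ^ 2 ∨ (a1 * j : ZMod n) ^ 2 = (a2 * k) ^ 2 := by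
      rw [← hmn']
      simp only [Multiset.insert_eq_cons, Multiset.mem_cons, Multiset.mem_singleton] at hm
      rcases hm with rfl | rfl | rfl | rfl <;> simp [Nat.cast_sub hp.one_le]
    rcases hsq with hsq | hsq
    · left
      rw [mul_pow, mul_pow] at hsq
      rcases sq_eq_sq_iff_eq_or_eq_neg.mp (mul_left_cancel₀ (pow_ne_zero 2 ha) hsq) with h | h
      · exact absurd h hjk'
      · rw [h, neg_add_cancel]
    · right
      refine (mul_eq_zero.mp (?_ : (a1 : ZMod n) ^ 2 * _ = 0)).resolve_left (pow_ne_zero 2 ha)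
      linear_combination hsq + (k : ZMod n) ^ 2 * hd
  · rintro (h | h)
    · rw [Real.cos_two_pi_mul_div_eq_of_sq_eq hp (x := a1 * j) (y := a1 * k),
        Real.cos_two_pi_mul_div_eq_of_sq_eq hp (x := a2 * j) (y := a2 * k)] <;>
      · push_cast
        rw [eq_neg_of_add_eq_zero_left h]
        ring
    · rw [Real.cos_two_pi_mul_div_eq_of_sq_eq hp (x := a1 * j) (y := a2 * k),
        Real.cos_two_pi_mul_div_eq_of_sq_eq hp (x := a2 * j) (y := a1 * k), add_comm]
      · push_cast
        linear_combination (a2 : ZMod n) ^ 2 * h - (k : ZMod n) ^ 2 * hd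
      · push_cast
        linear_combination (a1 : ZMod n) ^ 2 * h - (k : ZMod n) ^ 2 * hd
end

section
/- Let n be an odd prime and let 1 ≤ a_1 < a_2 < n/2 be integers with n ∤ (a_1² + a_2²). Then the adjacency matrix A(C_n(a_1, a_2)) has the simple eigenvalue 4, and every other eigenvalue of A(C_n(a_1, a_2)) has multiplicity exactly two. In particular, this holds for every prime n with n > a_1² + a_2² and a_2 < n/2. -/
open scoped Real

/-- The adjacency matrix (over ℝ) of the circulant graph `C_n(a_1,…,a_m)`:
vertices `i, j ∈ {0,…,n-1}` are adjacent iff `i - j ≡ ±a_k (mod n)` for some `k`. -/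
def circAdj (n m : ℕ) (a : Fin m → ℕ) : Matrix (Fin n) (Fin n) ℝ :=
  Matrix.of fun i j =>
    if ∃ k : Fin m, ((i : ℕ) : ZMod n) - ((j : ℕ) : ZMod n) = ((a k : ℕ) : ZMod n)
        ∨ ((i : ℕ) : ZMod n) - ((j : ℕ) : ZMod n) = -((a k : ℕ) : ZMod n)
    then 1 else 0

lemma Multiset.sum_count_mul_eq_sum_map {α R : Type*} [Fintype α] [DecidableEq α]
    [CommSemiring R] (s : Multiset α) (f : α → R) :
    ∑ x, (s.count x : R) * f x = (s.map f).sum := by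
  rw [Finset.sum_multiset_map_count]
  simp only [nsmul_eq_mul]
  symm
  refine Finset.sum_subset (Finset.subset_univ _) fun x _ hx => ?_
  simp [Multiset.count_eq_zero_of_notMem (by simpa using hx)]

namespace ZMod

lemma isPrimitiveRoot_stdAddChar_one (n : ℕ) [NeZero n] :
    IsPrimitiveRoot (stdAddChar (1 : ZMod n)) n := by
  have h : stdAddChar (1 : ZMod n) = Complex.exp (2 * π * Complex.I / n) := by
    simpa using stdAddChar_coe (N := n) 1
  rw [h]
  exact Complex.isPrimitiveRoot_exp n (NeZero.ne n)

/-- The bijection from `{0,…,n-1}` to `ZMod n` given by the natural number cast. -/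
def finCastEquiv (n : ℕ) [NeZero n] : Fin n ≃ ZMod n where
  toFun i := ((i : ℕ) : ZMod n)
  invFun x := ⟨x.val, x.val_lt⟩
  left_inv i := Fin.ext (ZMod.val_cast_of_lt i.isLt)
  right_inv x := ZMod.natCast_zmod_val x

lemma finCastEquiv_apply (n : ℕ) [NeZero n] (i : Fin n) :
    finCastEquiv n i = ((i : ℕ) : ZMod n) := rfl

/-- For `n` prime, an integral relation among the `n`-th roots of unity has constant
coefficients. -/
lemma eq_of_sum_mul_stdAddChar_eq_zero {n : ℕ} [NeZero n] (hn : n.Prime) (c : ZMod n → ℤ)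
    (h : ∑ x, (c x : ℂ) * stdAddChar x = 0) (x y : ZMod n) : c x = c y := by
  have key := (isPrimitiveRoot_stdAddChar_one n).sum_eq_zero_iff_forall_eq_int hn
    (fun i => c (finCastEquiv n i))
  have h' := key.1 (by
    rw [← h, ← (finCastEquiv n).sum_comp]
    refine Finset.sum_congr rfl fun i _ => ?_
    rw [← AddChar.map_nsmul_eq_pow, nsmul_one, finCastEquiv_apply])
  simpa using h' ((finCastEquiv n).symm x) ((finCastEquiv n).symm y)

/-- For `n` prime, a multiset of `n`-th roots of unity of given size is determined by its sum. -/
lemma multiset_eq_of_sum_stdAddChar_eq_s5 {n : ℕ} [NeZero n] (hn : n.Prime)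
    {s t : Multiset (ZMod n)} (hcard : s.card = t.card)
    (hsum : (s.map stdAddChar).sum = (t.map (stdAddChar (N := n))).sum) : s = t := by
  have hconst := eq_of_sum_mul_stdAddChar_eq_zero hn
    (fun x => (s.count x : ℤ) - t.count x) (by
      push_cast
      simp only [sub_mul, Finset.sum_sub_distrib]
      rw [Multiset.sum_count_mul_eq_sum_map, Multiset.sum_count_mul_eq_sum_map, hsum, sub_self])
  have htot : ∑ x, ((s.count x : ℤ) - t.count x) = 0 := by
    have hs := Multiset.sum_count_mul_eq_sum_map s (fun _ => (1 : ℤ))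
    have ht := Multiset.sum_count_mul_eq_sum_map t (fun _ => (1 : ℤ))
    simp only [mul_one, Multiset.map_const', Multiset.sum_replicate, nsmul_eq_mul] at hs ht
    rw [Finset.sum_sub_distrib, hs, ht, hcard, sub_self]
  ext y
  rw [Finset.sum_congr rfl fun x _ => hconst x y] at htot
  simp only [Finset.sum_const, Finset.card_univ, ZMod.card, nsmul_eq_mul, mul_eq_zero] at htot
  have := htot.resolve_left (by exact_mod_cast hn.ne_zero)
  omega

end ZMod

open ZMod

/-- The Fourier eigenvalue `ω^{ka} + ω^{-ka} + ω^{kb} + ω^{-kb}` of `C_n(a, b)`. -/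
noncomputable def circEigenvalue {n : ℕ} [NeZero n] (a b k : ZMod n) : ℂ :=
  stdAddChar (k * a) + stdAddChar (-(k * a)) + stdAddChar (k * b) + stdAddChar (-(k * b))

lemma circEigenvalue_zero {n : ℕ} [NeZero n] (a b : ZMod n) : circEigenvalue a b 0 = 4 := by
  norm_num [circEigenvalue]

lemma eq_or_eq_neg_of_circEigenvalue_eq {n : ℕ} [NeZero n] (hn : n.Prime) {a b j k : ZMod n}
    (ha : a ≠ 0) (hb : b ≠ 0) (hab : a ^ 2 ≠ b ^ 2) (hab' : a ^ 2 + b ^ 2 ≠ 0)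
    (h : circEigenvalue a b j = circEigenvalue a b k) : j = k ∨ j = -k := by
  have : Fact n.Prime := ⟨hn⟩
  have hm : ({j * a, -(j * a), j * b, -(j * b)} : Multiset (ZMod n))
      = {k * a, -(k * a), k * b, -(k * b)} := by
    refine multiset_eq_of_sum_stdAddChar_eq_s5 hn (by simp) ?_
    simpa [circEigenvalue, add_assoc] using h
  have cancel : ∀ c : ZMod n, c ≠ 0 → (j * c = k * c ∨ j * c = -(k * c)) → j = k ∨ j = -k := by
    rintro c hc (h | h)
    · exact Or.inl (mul_right_cancel₀ hc h)
    · exact Or.inr (mul_right_cancel₀ hc (by rw [h, neg_mul]))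
  have h₁ : j * a ∈ ({k * a, -(k * a), k * b, -(k * b)} : Multiset (ZMod n)) := by
    rw [← hm]; simp
  have h₂ : j * b ∈ ({k * a, -(k * a), k * b, -(k * b)} : Multiset (ZMod n)) := by
    rw [← hm]; simp
  simp only [Multiset.insert_eq_cons, Multiset.mem_cons, Multiset.mem_singleton] at h₁ h₂
  rw [← or_assoc] at h₁ h₂
  rcases h₁ with h₁ | h₁
  · exact cancel a ha h₁
  rcases h₂ with h₂ | h₂
  swap
  · exact cancel b hb h₂
  have hj : j = 0 := by
    by_contra hj
    have hk : k ≠ 0 := by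
      rintro rfl
      simp_all
    have e : (j * k) * (a ^ 2 - b ^ 2) = 0 ∨ (j * k) * (a ^ 2 + b ^ 2) = 0 := by
      rcases h₁ with h₁ | h₁ <;> rcases h₂ with h₂ | h₂
      · left; linear_combination (k * a) * h₁ - (k * b) * h₂
      · right; linear_combination (k * a) * h₁ + (k * b) * h₂
      · right; linear_combination (k * a) * h₁ + (k * b) * h₂
      · left; linear_combination (k * a) * h₁ - (k * b) * h₂
    simp [hj, hk, hab', sub_eq_zero, hab] at e
  subst hj
  left
  rcases h₁ with h₁ | h₁ <;> simp_all

lemma circAdj_mulVec_apply {n : ℕ} [NeZero n] {a b : ℕ} (ha : (a : ZMod n) ≠ -a)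
    (hb : (b : ZMod n) ≠ -b) (hab : (a : ZMod n) ≠ b) (hab' : (a : ZMod n) ≠ -b)
    (F : ZMod n → ℝ) (x : ZMod n) :
    (circAdj n 2 ![a, b]).mulVec (F ∘ finCastEquiv n) ((finCastEquiv n).symm x)
      = F (x - a) + F (x + a) + F (x - b) + F (x + b) := by
  have hab'' : -(a : ZMod n) ≠ b := fun h => hab' (by rw [← h, neg_neg])
  simp only [Matrix.mulVec, dotProduct, circAdj, Matrix.of_apply, ← finCastEquiv_apply,
    Equiv.apply_symm_apply, Function.comp_apply, Fin.exists_fin_two]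
  have key : ∀ y : ZMod n,
      (if (x - y = ((![a, b] 0 : ℕ) : ZMod n) ∨ x - y = -((![a, b] 0 : ℕ) : ZMod n)) ∨
        (x - y = ((![a, b] 1 : ℕ) : ZMod n) ∨ x - y = -((![a, b] 1 : ℕ) : ZMod n))
        then (1 : ℝ) else 0) * F y
      = (if y = x - a then F y else 0) + (if y = x + a then F y else 0)
        + (if y = x - b then F y else 0) + (if y = x + b then F y else 0) := by
    intro y
    have e₁ : ∀ c : ZMod n, y = x - c ↔ x - y = c := fun c => by grind
    have e₂ : ∀ c : ZMod n, y = x + c ↔ x - y = -c := fun c => by grind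
    simp only [e₁, e₂, Matrix.cons_val_zero, Matrix.cons_val_one]
    generalize x - y = d
    by_cases c₁ : d = a
    · subst c₁; simp [ha, hab, hab']
    by_cases c₂ : d = -a
    · subst c₂; simp [hab'', ha.symm, hab]
    by_cases c₃ : d = b
    · subst c₃; simp [hab.symm, hb, c₂]
    by_cases c₄ : d = -b
    · subst c₄; simp [hb.symm, c₁, hab.symm]
    simp [c₁, c₂, c₃, c₄]
  rw [Finset.sum_congr rfl fun i _ => by convert key (finCastEquiv n i)]
  rw [(finCastEquiv n).sum_comp fun y => (if y = x - a then F y else 0)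
    + (if y = x + a then F y else 0) + (if y = x - b then F y else 0)
    + (if y = x + b then F y else 0)]
  simp [Finset.sum_add_distrib]

section Eigenspace

variable {n : ℕ} [NeZero n] {a b : ℕ}

/-- The real-linear discrete Fourier coefficient at `k` of a real vector on `{0,…,n-1}`. -/
noncomputable def finDFT (n : ℕ) [NeZero n] (k : ZMod n) : (Fin n → ℝ) →ₗ[ℝ] ℂ where
  toFun f := dft (fun x : ZMod n => ((f ((finCastEquiv n).symm x) : ℝ) : ℂ)) k
  map_add' f g := by
    simp [dft_apply, mul_add, Finset.sum_add_distrib]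
  map_smul' c f := by
    simp only [dft_apply, Pi.smul_apply, smul_eq_mul, Complex.ofReal_mul, RingHom.id_apply,
      Complex.real_smul, Finset.mul_sum]
    exact Finset.sum_congr rfl fun x _ => by ring

lemma finDFT_apply (k : ZMod n) (f : Fin n → ℝ) :
    finDFT n k f = ∑ x, stdAddChar (-(x * k)) * ((f ((finCastEquiv n).symm x) : ℝ) : ℂ) := rfl

lemma eq_zero_of_finDFT_eq_zero {f : Fin n → ℝ} (h : ∀ k, finDFT n k f = 0) : f = 0 := by
  have h' : dft (fun x : ZMod n => ((f ((finCastEquiv n).symm x) : ℝ) : ℂ)) = 0 := funext h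
  rw [LinearEquiv.map_eq_zero_iff] at h'
  ext i
  simpa using congrFun h' (finCastEquiv n i)

lemma conj_stdAddChar (x : ZMod n) :
    (starRingEnd ℂ) (stdAddChar x) = stdAddChar (-x) := by
  rw [AddChar.map_neg_eq_conj]

lemma finDFT_neg (k : ZMod n) (f : Fin n → ℝ) :
    finDFT n (-k) f = (starRingEnd ℂ) (finDFT n k f) := by
  simp only [finDFT_apply, map_sum, map_mul, conj_stdAddChar, Complex.conj_ofReal]
  simp

lemma sum_stdAddChar_mul_shift (k c : ZMod n) (F : ZMod n → ℂ) :
    ∑ x, stdAddChar (-(x * k)) * F (x + c)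
      = stdAddChar (k * c) * ∑ x, stdAddChar (-(x * k)) * F x := by
  rw [← Equiv.sum_comp (Equiv.addRight c) (fun x => stdAddChar (-(x * k)) * F x), Finset.mul_sum]
  refine Finset.sum_congr rfl fun x _ => ?_
  rw [Equiv.coe_addRight, ← mul_assoc, ← AddChar.map_add_eq_mul]
  congr 2
  ring

lemma finDFT_circAdj (ha : (a : ZMod n) ≠ -a)
    (hb : (b : ZMod n) ≠ -b) (hab : (a : ZMod n) ≠ b) (hab' : (a : ZMod n) ≠ -b)
    (k : ZMod n) (f : Fin n → ℝ) :
    finDFT n k ((circAdj n 2 ![a, b]).mulVec f)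
      = circEigenvalue (a : ZMod n) b k * finDFT n k f := by
  have hf : f = (f ∘ (finCastEquiv n).symm) ∘ finCastEquiv n := by ext; simp
  have e := circAdj_mulVec_apply ha hb hab hab' (f ∘ (finCastEquiv n).symm)
  rw [← hf] at e
  simp only [finDFT_apply, e, Complex.ofReal_add, mul_add, Finset.sum_add_distrib, sub_eq_add_neg]
  have s := fun c => sum_stdAddChar_mul_shift k c
    (fun x => ((f ((finCastEquiv n).symm x) : ℝ) : ℂ))
  simp only [Function.comp_apply, s, circEigenvalue, mul_neg]
  ring

/-- The real wave `x ↦ Re (z ω^{kx})` on `{0,…,n-1}`, linear in its complex amplitude `z`. -/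
noncomputable def finWave (n : ℕ) [NeZero n] (k : ZMod n) : ℂ →ₗ[ℝ] (Fin n → ℝ) where
  toFun z i := (z * stdAddChar (k * finCastEquiv n i)).re
  map_add' z w := by ext; simp [add_mul]
  map_smul' c z := by ext; simp [mul_assoc]

lemma circAdj_mulVec_finWave (ha : (a : ZMod n) ≠ -a)
    (hb : (b : ZMod n) ≠ -b) (hab : (a : ZMod n) ≠ b) (hab' : (a : ZMod n) ≠ -b)
    {k : ZMod n} {μ : ℝ} (hμ : circEigenvalue (a : ZMod n) b k = μ) (z : ℂ) :
    (circAdj n 2 ![a, b]).mulVec (finWave n k z) = μ • finWave n k z := by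
  ext i
  have e := circAdj_mulVec_apply ha hb hab hab'
    (fun x => (z * stdAddChar (k * x)).re) (finCastEquiv n i)
  rw [Equiv.symm_apply_apply] at e
  refine e.trans ?_
  simp only [Pi.smul_apply, smul_eq_mul, finWave, LinearMap.coe_mk, AddHom.coe_mk]
  rw [← Complex.re_ofReal_mul, ← hμ, ← Complex.add_re, ← Complex.add_re, ← Complex.add_re]
  congr 1
  simp only [circEigenvalue, sub_eq_add_neg, mul_add, mul_neg, AddChar.map_add_eq_mul]
  ring

lemma finWave_injective (hn : n.Prime) (hodd : Odd n) {k : ZMod n} (hk : k ≠ 0) :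
    Function.Injective (finWave n k) := by
  have : Fact n.Prime := ⟨hn⟩
  rw [← LinearMap.ker_eq_bot, LinearMap.ker_eq_bot']
  intro z hz
  have hx : ∀ x : ZMod n, (z * stdAddChar (k * x)).re = 0 := fun x => by
    simpa [finWave] using congrFun hz ((finCastEquiv n).symm x)
  have hre : z.re = 0 := by simpa using hx 0
  have h1 := hx k⁻¹
  rw [mul_inv_cancel₀ hk, Complex.mul_re, hre, zero_mul, zero_sub, neg_eq_zero, mul_eq_zero] at h1
  rcases h1 with h1 | h1
  · exact Complex.ext hre h1
  · exfalso
    have h2 := Complex.conj_eq_iff_im.2 h1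
    rw [conj_stdAddChar, injective_stdAddChar.eq_iff] at h2
    exact (ZMod.ne_neg_self hodd one_ne_zero) h2.symm

end Eigenspace

/-- For `n` an odd prime not dividing `a ^ 2 + b ^ 2`, the spectrum of `C_n(a, b)` is only as
degenerate as the symmetry `k ↦ -k` of the Fourier eigenvalues forces. -/
lemma finrank_eigenspace_circAdj {n : ℕ} (hn : n.Prime) (hodd : Odd n) {a b : ℕ} (ha : 1 ≤ a)
    (hab : a < b) (hbn : 2 * b < n) (hdvd : ¬ n ∣ a ^ 2 + b ^ 2) :
    Module.End.HasEigenvalue (Matrix.toLin' (circAdj n 2 ![a, b])) 4 ∧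
      Module.finrank ℝ
        (Module.End.eigenspace (Matrix.toLin' (circAdj n 2 ![a, b])) 4) = 1 ∧
      ∀ μ : ℝ, Module.End.HasEigenvalue (Matrix.toLin' (circAdj n 2 ![a, b])) μ →
        μ ≠ 4 →
        Module.finrank ℝ
          (Module.End.eigenspace (Matrix.toLin' (circAdj n 2 ![a, b])) μ) = 2 := by
  have : Fact n.Prime := ⟨hn⟩
  have hcast : ∀ c : ℕ, 0 < c → c < n → (c : ZMod n) ≠ 0 := fun c h₀ h h' =>
    Nat.not_dvd_of_pos_of_lt h₀ h ((ZMod.natCast_eq_zero_iff c n).1 h')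
  have ha₀ : (a : ZMod n) ≠ 0 := hcast a (by omega) (by omega)
  have hb₀ : (b : ZMod n) ≠ 0 := hcast b (by omega) (by omega)
  have hane := ZMod.ne_neg_self hodd ha₀
  have hbne := ZMod.ne_neg_self hodd hb₀
  have hne : (a : ZMod n) ≠ b := fun h => hcast (b - a) (by omega) (by omega) (by
    rw [Nat.cast_sub hab.le, h, sub_self])
  have hne' : (a : ZMod n) ≠ -b := fun h => hcast (a + b) (by omega) (by omega) (by
    rw [Nat.cast_add, h, neg_add_cancel])
  have hsq : (a : ZMod n) ^ 2 ≠ (b : ZMod n) ^ 2 := fun h => by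
    rcases sq_eq_sq_iff_eq_or_eq_neg.1 h with h | h
    · exact hne h
    · exact hne' h
  have hsum : (a : ZMod n) ^ 2 + (b : ZMod n) ^ 2 ≠ 0 := fun h => hdvd (by
    rw [← ZMod.natCast_eq_zero_iff]; exact_mod_cast h)
  set T := Matrix.toLin' (circAdj n 2 ![a, b]) with hT
  have hmem : ∀ {μ : ℝ} {f : Fin n → ℝ}, f ∈ Module.End.eigenspace T μ ↔
      (circAdj n 2 ![a, b]).mulVec f = μ • f := by
    intro μ f
    rw [Module.End.mem_eigenspace_iff, hT, Matrix.toLin'_apply]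
  have hcoeff : ∀ {μ : ℝ} {f : Fin n → ℝ}, f ∈ Module.End.eigenspace T μ → ∀ k : ZMod n,
      circEigenvalue (a : ZMod n) b k = μ ∨ finDFT n k f = 0 := by
    intro μ f hf k
    have h := finDFT_circAdj hane hbne hne hne' k f
    rw [hmem.1 hf, LinearMap.map_smul, Complex.real_smul] at h
    by_cases h0 : finDFT n k f = 0
    · exact Or.inr h0
    · exact Or.inl (mul_right_cancel₀ h0 h).symm
  have hinj : ∀ {μ : ℝ} {j : ZMod n}, circEigenvalue (a : ZMod n) b j = μ →
      ∀ f ∈ Module.End.eigenspace T μ, finDFT n j f = 0 → f = 0 := by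
    intro μ j hj f hf h0
    refine eq_zero_of_finDFT_eq_zero fun k => ?_
    rcases hcoeff hf k with hk | hk
    · rcases eq_or_eq_neg_of_circEigenvalue_eq hn ha₀ hb₀ hsq hsum (hk.trans hj.symm) with rfl | rfl
      · exact h0
      · rw [finDFT_neg, h0, map_zero]
    · exact hk
  have hwave : ∀ {μ : ℝ} {j : ZMod n}, circEigenvalue (a : ZMod n) b j = μ → ∀ z : ℂ,
      finWave n j z ∈ Module.End.eigenspace T μ := fun hj z =>
    hmem.2 (circAdj_mulVec_finWave hane hbne hne hne' hj z)
  have h4 : circEigenvalue (a : ZMod n) b 0 = (4 : ℝ) := by rw [circEigenvalue_zero]; norm_num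
  have hone : Module.finrank ℝ (Module.End.eigenspace T 4) = 1 := by
    apply le_antisymm
    · have hre : ∀ f : Fin n → ℝ, (finDFT n 0 f).im = 0 := fun f =>
        Complex.conj_eq_iff_im.1 (by rw [← finDFT_neg, neg_zero])
      rw [← Module.finrank_self ℝ]
      refine LinearMap.finrank_le_finrank_of_injective
        (f := (Complex.reLm ∘ₗ finDFT n 0).domRestrict (Module.End.eigenspace T 4)) ?_
      rw [← LinearMap.ker_eq_bot, LinearMap.ker_eq_bot']
      rintro ⟨f, hf⟩ h0
      exact Subtype.ext (hinj h4 f hf (Complex.ext h0 (hre f)))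
    · rw [Nat.one_le_iff_ne_zero, ← Nat.pos_iff_ne_zero, Module.finrank_pos_iff_exists_ne_zero]
      refine ⟨⟨_, hwave h4 1⟩, fun h => ?_⟩
      have := congrFun (congrArg Subtype.val h) 0
      simp [finWave] at this
  refine ⟨?_, hone, fun μ hμ hne4 => ?_⟩
  · rw [Module.End.hasEigenvalue_iff]
    intro h
    rw [h, finrank_bot] at hone
    exact zero_ne_one hone
  · obtain ⟨f, hf, hf0⟩ := hμ.exists_hasEigenvector
    obtain ⟨j, hj⟩ : ∃ j : ZMod n, circEigenvalue (a : ZMod n) b j = μ := by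
      by_contra! h
      exact hf0 (eq_zero_of_finDFT_eq_zero fun k => (hcoeff hf k).resolve_left (h k))
    have hj0 : j ≠ 0 := by
      rintro rfl
      exact hne4 (Complex.ofReal_injective (hj.symm.trans h4))
    apply le_antisymm
    · rw [← Complex.finrank_real_complex]
      refine LinearMap.finrank_le_finrank_of_injective
        (f := (finDFT n j).domRestrict (Module.End.eigenspace T μ)) ?_
      rw [← LinearMap.ker_eq_bot, LinearMap.ker_eq_bot']
      rintro ⟨f, hf⟩ h0
      exact Subtype.ext (hinj hj f hf h0)
    · rw [← Complex.finrank_real_complex]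
      refine LinearMap.finrank_le_finrank_of_injective
        (f := (finWave n j).codRestrict (Module.End.eigenspace T μ) (hwave hj)) ?_
      intro z w hzw
      exact finWave_injective hn hodd hj0 (congrArg Subtype.val hzw)

theorem statement5 (a1 a2 : ℕ) (h1 : 1 ≤ a1) (h12 : a1 < a2) :
    -- For every odd prime `n` with `a_2 < n/2` and `n ∤ (a_1² + a_2²)`,
    -- the adjacency matrix of `C_n(a_1, a_2)` has the simple eigenvalue 4
    -- and every other eigenvalue has multiplicity exactly two.
    (∀ n : ℕ, n.Prime → Odd n → 2 * a2 < n → ¬ (n ∣ a1 ^ 2 + a2 ^ 2) →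
      (Module.End.HasEigenvalue (Matrix.toLin' (circAdj n 2 ![a1, a2])) 4 ∧
        Module.finrank ℝ
          (Module.End.eigenspace (Matrix.toLin' (circAdj n 2 ![a1, a2])) 4) = 1 ∧
        ∀ μ : ℝ, Module.End.HasEigenvalue (Matrix.toLin' (circAdj n 2 ![a1, a2])) μ →
          μ ≠ 4 →
          Module.finrank ℝ
            (Module.End.eigenspace (Matrix.toLin' (circAdj n 2 ![a1, a2])) μ) = 2)) ∧
    -- In particular, this holds for every prime `n > a_1² + a_2²` with `a_2 < n/2`.
    (∀ n : ℕ, n.Prime → 2 * a2 < n → a1 ^ 2 + a2 ^ 2 < n →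
      (Module.End.HasEigenvalue (Matrix.toLin' (circAdj n 2 ![a1, a2])) 4 ∧
        Module.finrank ℝ
          (Module.End.eigenspace (Matrix.toLin' (circAdj n 2 ![a1, a2])) 4) = 1 ∧
        ∀ μ : ℝ, Module.End.HasEigenvalue (Matrix.toLin' (circAdj n 2 ![a1, a2])) μ →
          μ ≠ 4 →
          Module.finrank ℝ
            (Module.End.eigenspace (Matrix.toLin' (circAdj n 2 ![a1, a2])) μ) = 2)) := by
  refine ⟨fun n hn hodd h hd => finrank_eigenspace_circAdj hn hodd h1 h12 h hd,
    fun n hn h hlt => finrank_eigenspace_circAdj hn (hn.odd_of_ne_two (by omega)) h1 h12 h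
      (Nat.not_dvd_of_pos_of_lt (by positivity) hlt)⟩
end

section
/- Let n be a prime, ω = e^{2πi/n}, let 1 ≤ a_1 < a_2 < n/2 be integers, and let j, k ∈ {1,...,n-1}. If ω^{a_1 j} = ω^{a_2 k}, ω^{a_2 j} = ω^{-a_1 k}, ω^{-a_1 j} = ω^{-a_2 k}, and ω^{-a_2 j} = ω^{a_1 k}, then n | (a_1² + a_2²) and n | (j² + k²). -/
open scoped Real

/-- `ω = e^{2πi/n}`, a primitive `n`-th root of unity in ℂ. -/
noncomputable def rootOfUnity' (n : ℕ) : ℂ := Complex.exp (2 * π * Complex.I / n)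

/-- Two integer powers of a primitive `n`-th root of unity agree exactly when `n` divides the
difference of the exponents. -/
theorem IsPrimitiveRoot.zpow_eq_zpow_iff_dvd_sub {K : Type*} [Field K] {ζ : K} {n : ℕ}
    (h : IsPrimitiveRoot ζ n) (hn : n ≠ 0) (x y : ℤ) : ζ ^ x = ζ ^ y ↔ (n : ℤ) ∣ x - y := by
  have hζ : ζ ≠ 0 := h.ne_zero hn
  rw [← h.zpow_eq_one_iff_dvd, zpow_sub₀ hζ, div_eq_one_iff_eq (zpow_ne_zero _ hζ)]

theorem statement8 (n : ℕ) (hp : n.Prime) (a1 a2 : ℕ)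
    (h1 : 1 ≤ a1) (h12 : a1 < a2) (h2 : 2 * a2 < n)
    (j k : ℕ) (hj1 : 1 ≤ j) (hjn : j ≤ n - 1) (hk1 : 1 ≤ k) (hkn : k ≤ n - 1)
    (e1 : rootOfUnity' n ^ ((a1 : ℤ) * j) = rootOfUnity' n ^ ((a2 : ℤ) * k))
    (e2 : rootOfUnity' n ^ ((a2 : ℤ) * j) = rootOfUnity' n ^ (-((a1 : ℤ) * k)))
    (e3 : rootOfUnity' n ^ (-((a1 : ℤ) * j)) = rootOfUnity' n ^ (-((a2 : ℤ) * k)))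
    (e4 : rootOfUnity' n ^ (-((a2 : ℤ) * j)) = rootOfUnity' n ^ ((a1 : ℤ) * k)) :
    n ∣ a1 ^ 2 + a2 ^ 2 ∧ n ∣ j ^ 2 + k ^ 2 := by
  have hζ : IsPrimitiveRoot (rootOfUnity' n) n := Complex.isPrimitiveRoot_exp n hp.ne_zero
  have hd1 := (hζ.zpow_eq_zpow_iff_dvd_sub hp.ne_zero _ _).1 e1
  have hd2 := (hζ.zpow_eq_zpow_iff_dvd_sub hp.ne_zero _ _).1 e2
  have hk : ¬ n ∣ k := Nat.not_dvd_of_pos_of_lt (by omega) (by omega)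
  have ha2 : ¬ n ∣ a2 := Nat.not_dvd_of_pos_of_lt (by omega) (by omega)
  constructor
  · refine (hp.dvd_mul.1 ?_).resolve_left hk
    zify
    rw [show (k : ℤ) * (a1 ^ 2 + a2 ^ 2) =
        a1 * (a2 * j - -(a1 * k)) - a2 * (a1 * j - a2 * k) by ring]
    exact dvd_sub (hd2.mul_left _) (hd1.mul_left _)
  · refine (hp.dvd_mul.1 ?_).resolve_left ha2
    zify
    rw [show (a2 : ℤ) * (j ^ 2 + k ^ 2) =
        j * (a2 * j - -(a1 * k)) - k * (a1 * j - a2 * k) by ring]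
    exact dvd_sub (hd2.mul_left _) (hd1.mul_left _)
end

section
/- Let 0 < p < √6/π and let n range over odd integers n ≥ 3. For each such n let m_n = ⌊np/2⌋, let S_n = {n - m_n, n - m_n + 1, ..., n-1, 0, 1, ..., m_n} ⊆ {0,...,n-1}, and let s_{(n-1)/2} ∈ ℝ^n be the unit vector with k-th entry √(2/n) sin(2π((n-1)/2)k/n) = ±√(2/n) sin(πk/n). Then |S_n|/n → p as n → ∞, μ_{s_{(n-1)/2}}(S_n) = (4/n) Σ_{k=1}^{m_n} sin²(πk/n), and limsup_{n→∞} μ_{s_{(n-1)/2}}(S_n) ≤ π²p³/6 < p. In particular, μ_{s_{(n-1)/2}}(S_n) does not converge to p. -/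
open scoped Real

/-- `m_n = ⌊np/2⌋`. -/
noncomputable def mfloor (p : ℝ) (n : ℕ) : ℕ := ⌊(n : ℝ) * p / 2⌋₊

/-- The vertex subset `S_n = {n - m_n, …, n-1, 0, 1, …, m_n} ⊆ {0,…,n-1}`,
where `m_n = ⌊np/2⌋`. -/
noncomputable def Sband (p : ℝ) (n : ℕ) : Finset (Fin n) :=
  Finset.univ.filter fun k => (k : ℕ) ≤ mfloor p n ∨ n - mfloor p n ≤ (k : ℕ)

/-- The vector `s_{(n-1)/2} ∈ ℝ^n` with `k`-th entry `√(2/n) sin(2π((n-1)/2)k/n)`. -/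
noncomputable def shalf (n : ℕ) : Fin n → ℝ :=
  fun k => Real.sqrt (2 / n) * Real.sin (2 * π * (((n - 1) / 2 : ℕ)) * (k : ℕ) / n)

/-- The filter of `n → ∞` along odd integers. -/
def oddAtTop : Filter ℕ := Filter.atTop ⊓ Filter.principal {n | Odd n}

open Filter Finset

instance oddAtTop_neBot : NeBot oddAtTop :=
  Filter.inf_principal_neBot_iff.2 fun U hU => by
    obtain ⟨k, hk⟩ := mem_atTop_sets.1 hU
    exact ⟨2 * k + 1, hk _ (by omega), odd_two_mul_add_one k⟩

theorem eventually_oddAtTop : ∀ᶠ n in oddAtTop, Odd n ∧ 3 ≤ n := by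
  filter_upwards [mem_inf_of_right (mem_principal_self _),
    mem_inf_of_left (eventually_ge_atTop 3)] with n h₁ h₂ using ⟨h₁, h₂⟩

theorem mfloor_le {p : ℝ} (hp : 0 ≤ p) (n : ℕ) : (mfloor p n : ℝ) ≤ n * p / 2 :=
  Nat.floor_le (by positivity)

theorem two_mul_mfloor_lt {p : ℝ} (hp0 : 0 ≤ p) (hp1 : p < 1) {n : ℕ} (hn : 0 < n) :
    2 * mfloor p n < n := by
  have h := mfloor_le hp0 n
  have hn' : (0 : ℝ) < n := by exact_mod_cast hn
  have : (2 : ℝ) * mfloor p n < n := by nlinarith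
  exact_mod_cast this

/-- A sum over `S_n` pairs each `k ∈ {1, …, m_n}` with its reflection `n - k`. -/
theorem sum_Sband {p : ℝ} {n : ℕ} (h : 2 * mfloor p n < n) (f : ℕ → ℝ) :
    ∑ k ∈ Sband p n, f k = f 0 + ∑ k ∈ Icc 1 (mfloor p n), (f k + f (n - k)) := by
  set m := mfloor p n with hm
  have hset : (range n).filter (fun k => k ≤ m ∨ n - m ≤ k) =
      insert 0 (Icc 1 m ∪ (Icc 1 m).image (fun k => n - k)) := by
    ext k
    simp only [mem_filter, mem_range, mem_insert, mem_union, mem_Icc, mem_image]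
    constructor
    · rintro ⟨hk, h1 | h1⟩
      · omega
      · exact Or.inr (Or.inr ⟨n - k, by omega, by omega⟩)
    · rintro (h1 | h1 | ⟨j, hj, rfl⟩) <;> omega
  have hdisj : Disjoint (Icc 1 m) ((Icc 1 m).image (fun k => n - k)) := by
    rw [disjoint_left]
    intro k hk hk'
    simp only [mem_Icc, mem_image] at hk hk'
    obtain ⟨j, hj, hjk⟩ := hk'
    omega
  have hzero : 0 ∉ Icc 1 m ∪ (Icc 1 m).image (fun k => n - k) := by
    simp only [mem_union, mem_Icc, mem_image]
    rintro (h1 | ⟨j, hj, hjk⟩) <;> omega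
  have hinj : Set.InjOn (fun k => n - k) (Icc 1 m : Finset ℕ) := by
    intro a ha b hb hab
    simp only [coe_Icc, Set.mem_Icc] at ha hb hab
    omega
  rw [Sband, sum_filter, Fin.sum_univ_eq_sum_range
    (fun k => if k ≤ mfloor p n ∨ n - mfloor p n ≤ k then f k else 0), ← sum_filter, ← hm, hset,
    sum_insert hzero, sum_union hdisj, sum_image hinj, sum_add_distrib]

theorem card_Sband {p : ℝ} {n : ℕ} (h : 2 * mfloor p n < n) :
    (#(Sband p n) : ℝ) = 1 + 2 * mfloor p n := by
  have := sum_Sband h (fun _ => 1)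
  simp only [sum_const, nsmul_eq_mul, mul_one, Nat.card_Icc, add_tsub_cancel_right] at this
  rw [this]
  ring

theorem shalf_eq {n : ℕ} (hn : Odd n) (k : Fin n) :
    shalf n k = Real.sqrt (2 / n) * Real.sin (π * (k : ℕ) / n) ∨
      shalf n k = -(Real.sqrt (2 / n) * Real.sin (π * (k : ℕ) / n)) := by
  obtain ⟨t, rfl⟩ := hn
  have harg : 2 * π * (((2 * t + 1 - 1) / 2 : ℕ)) * (k : ℕ) / ((2 * t + 1 : ℕ) : ℝ) =
      (k : ℕ) * π - π * (k : ℕ) / ((2 * t + 1 : ℕ) : ℝ) := by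
    have h : (2 * t + 1 - 1) / 2 = t := by omega
    rw [h]
    push_cast
    field_simp
    ring
  rw [shalf, harg, Real.sin_nat_mul_pi_sub]
  rcases neg_one_pow_eq_or ℝ (k : ℕ) with h | h <;> simp [h]

theorem shalf_sq {n : ℕ} (hn : Odd n) (k : Fin n) :
    shalf n k ^ 2 = 2 / n * Real.sin (π * (k : ℕ) / n) ^ 2 := by
  have h : (0 : ℝ) ≤ 2 / n := by positivity
  rcases shalf_eq hn k with h' | h' <;>
    simp only [h', neg_sq, mul_pow, Real.sq_sqrt h]

theorem sum_cos_two_pi_mul_div {n : ℕ} (hn : 1 < n) :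
    ∑ k ∈ range n, Real.cos (2 * π * k / n) = 0 := by
  have h := (Complex.isPrimitiveRoot_exp n (by omega)).geom_sum_eq_zero hn
  have h' := congrArg Complex.re h
  rw [Complex.re_sum, Complex.zero_re] at h'
  rw [← h']
  refine sum_congr rfl fun k _ => ?_
  rw [← Complex.exp_nat_mul, ← Complex.exp_ofReal_mul_I_re]
  congr 2
  push_cast
  ring

theorem sum_sin_sq_pi_mul_div {n : ℕ} (hn : 1 < n) :
    ∑ k ∈ range n, Real.sin (π * k / n) ^ 2 = n / 2 := by
  have h (k : ℕ) : Real.sin (π * k / n) ^ 2 = 1 / 2 - Real.cos (2 * π * k / n) / 2 := by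
    rw [Real.sin_sq_eq_half_sub]
    congr 3
    ring
  simp only [h, sum_sub_distrib, ← sum_div, sum_cos_two_pi_mul_div hn]
  simp [div_eq_mul_inv]

theorem sum_shalf_sq {n : ℕ} (hn : Odd n) (h1 : 1 < n) : ∑ k : Fin n, shalf n k ^ 2 = 1 := by
  simp only [shalf_sq hn]
  rw [Fin.sum_univ_eq_sum_range (fun k => 2 / (n : ℝ) * Real.sin (π * k / n) ^ 2), ← mul_sum,
    sum_sin_sq_pi_mul_div h1]
  have : (n : ℝ) ≠ 0 := by positivity
  field_simp

theorem sum_Sband_shalf_sq {p : ℝ} {n : ℕ} (hn : Odd n) (h : 2 * mfloor p n < n) :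
    ∑ k ∈ Sband p n, shalf n k ^ 2 =
      (4 / n) * ∑ k ∈ Icc 1 (mfloor p n), Real.sin (π * k / n) ^ 2 := by
  have hn0 : (n : ℝ) ≠ 0 := by
    have : n ≠ 0 := by omega
    exact_mod_cast this
  simp only [shalf_sq hn]
  rw [sum_Sband h (fun k => 2 / (n : ℝ) * Real.sin (π * k / n) ^ 2), mul_sum]
  simp only [Nat.cast_zero, mul_zero, zero_div, Real.sin_zero, ne_eq, OfNat.ofNat_ne_zero,
    not_false_eq_true, zero_pow, zero_add]
  refine sum_congr rfl fun k hk => ?_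
  rw [mem_Icc] at hk
  have harg : π * ((n - k : ℕ) : ℝ) / n = π - π * k / n := by
    rw [Nat.cast_sub (by omega)]
    field_simp
  rw [harg, Real.sin_pi_sub]
  ring

theorem sum_Icc_sq (m : ℕ) :
    ∑ k ∈ Icc 1 m, (k : ℝ) ^ 2 = m * (m + 1) * (2 * m + 1) / 6 := by
  induction m with
  | zero => simp
  | succ m ih =>
    rw [sum_Icc_succ_top (by omega), ih]
    push_cast
    ring

theorem sum_Sband_shalf_sq_le {p : ℝ} (hp : 0 ≤ p) {n : ℕ} (hn : Odd n)
    (h : 2 * mfloor p n < n) :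
    ∑ k ∈ Sband p n, shalf n k ^ 2 ≤
      π ^ 2 / 3 * (p * (p / 2 + (n : ℝ)⁻¹) * (p + (n : ℝ)⁻¹)) := by
  have hn0 : (0 : ℝ) < n := by
    have : 0 < n := by omega
    exact_mod_cast this
  have hm := mfloor_le hp n
  rw [sum_Sband_shalf_sq hn h]
  calc (4 / n : ℝ) * ∑ k ∈ Icc 1 (mfloor p n), Real.sin (π * k / n) ^ 2
      ≤ 4 / n * ∑ k ∈ Icc 1 (mfloor p n), (π / n) ^ 2 * (k : ℝ) ^ 2 := by
        gcongr with k hk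
        rw [← mul_pow, div_mul_eq_mul_div]
        exact sq_le_sq.2 Real.abs_sin_le_abs
    _ = 4 / n * ((π / n) ^ 2 *
          (mfloor p n * (mfloor p n + 1) * (2 * mfloor p n + 1) / 6)) := by
        rw [← mul_sum, sum_Icc_sq]
    _ ≤ 4 / n * ((π / n) ^ 2 *
          ((n * p / 2) * (n * p / 2 + 1) * (2 * (n * p / 2) + 1) / 6)) := by gcongr
    _ = π ^ 2 / 3 * (p * (p / 2 + (n : ℝ)⁻¹) * (p + (n : ℝ)⁻¹)) := by
        field_simp
        ring

theorem tendsto_card_Sband_div {p : ℝ} (hp0 : 0 ≤ p) (hp1 : p < 1) :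
    Tendsto (fun n => (#(Sband p n) : ℝ) / n) oddAtTop (nhds p) := by
  have hfloor : Tendsto (fun n : ℕ => (mfloor p n : ℝ) / n) atTop (nhds (p / 2)) := by
    refine ((tendsto_nat_floor_mul_div_atTop (by positivity : 0 ≤ p / 2)).comp
      (tendsto_natCast_atTop_atTop (R := ℝ))).congr fun n => ?_
    simp only [Function.comp_apply, mfloor]
    congr 3
    ring
  have hlim := (tendsto_inv_atTop_nhds_zero_nat (𝕜 := ℝ)).add (hfloor.const_mul 2)
  rw [zero_add, mul_div_cancel₀ p (two_ne_zero' ℝ)] at hlim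
  refine (hlim.mono_left inf_le_left).congr' ?_
  filter_upwards [eventually_oddAtTop] with n hn
  rw [card_Sband (two_mul_mfloor_lt hp0 hp1 (by omega))]
  ring

theorem limsup_sum_Sband_shalf_sq_le {p : ℝ} (hp0 : 0 ≤ p) (hp1 : p < 1) :
    limsup (fun n => ∑ k ∈ Sband p n, shalf n k ^ 2) oddAtTop ≤ π ^ 2 * p ^ 3 / 6 := by
  have hinv : Tendsto (fun n : ℕ => (n : ℝ)⁻¹) oddAtTop (nhds 0) :=
    tendsto_inv_atTop_nhds_zero_nat.mono_left inf_le_left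
  have hlim : Tendsto (fun n : ℕ => π ^ 2 / 3 * (p * (p / 2 + (n : ℝ)⁻¹) * (p + (n : ℝ)⁻¹)))
      oddAtTop (nhds (π ^ 2 * p ^ 3 / 6)) := by
    convert (((hinv.const_add (p / 2)).const_mul p).mul (hinv.const_add p)).const_mul
      (π ^ 2 / 3) using 2
    ring
  rw [← hlim.limsup_eq]
  refine limsup_le_limsup ?_ ?_ hlim.isBoundedUnder_le
  · filter_upwards [eventually_oddAtTop] with n hn
    exact sum_Sband_shalf_sq_le hp0 hn.1 (two_mul_mfloor_lt hp0 hp1 (by omega))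
  · exact (isBoundedUnder_of ⟨0, fun n => sum_nonneg fun k _ => sq_nonneg _⟩).isCoboundedUnder_le

theorem statement11 (p : ℝ) (hp0 : 0 < p) (hp1 : p < Real.sqrt 6 / π) :
    -- for odd `n ≥ 3`, `s_{(n-1)/2}` is a unit vector whose `k`-th entry is
    -- `± √(2/n) sin(πk/n)`,
    (∀ n : ℕ, Odd n → 3 ≤ n →
      (∑ k : Fin n, shalf n k ^ 2 = 1) ∧
      ∀ k : Fin n,
        shalf n k = Real.sqrt (2 / n) * Real.sin (π * (k : ℕ) / n) ∨
        shalf n k = -(Real.sqrt (2 / n) * Real.sin (π * (k : ℕ) / n))) ∧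
    -- `|S_n|/n → p` as `n → ∞` along odd `n`,
    Filter.Tendsto (fun n => ((Sband p n).card : ℝ) / n) oddAtTop (nhds p) ∧
    -- `μ_{s_{(n-1)/2}}(S_n) = (4/n) Σ_{k=1}^{m_n} sin²(πk/n)`,
    (∀ n : ℕ, Odd n → 3 ≤ n →
      ∑ k ∈ Sband p n, shalf n k ^ 2
        = (4 / n) * ∑ k ∈ Finset.Icc 1 (mfloor p n), Real.sin (π * k / n) ^ 2) ∧
    -- `limsup μ_{s_{(n-1)/2}}(S_n) ≤ π²p³/6 < p`,
    Filter.limsup (fun n => ∑ k ∈ Sband p n, shalf n k ^ 2) oddAtTop ≤ π ^ 2 * p ^ 3 / 6 ∧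
    π ^ 2 * p ^ 3 / 6 < p ∧
    -- and in particular `μ_{s_{(n-1)/2}}(S_n)` does not converge to `p`.
    ¬ Filter.Tendsto (fun n => ∑ k ∈ Sband p n, shalf n k ^ 2) oddAtTop (nhds p) := by
  have hpi : p * π < √6 := (lt_div_iff₀ Real.pi_pos).1 hp1
  have hsq : (p * π) ^ 2 < 6 := by
    calc (p * π) ^ 2 < √6 ^ 2 := by gcongr
      _ = 6 := Real.sq_sqrt (by norm_num)
  have hp1' : p < 1 := by
    by_contra! h
    have h3 : 3 < p * π := by nlinarith [Real.pi_gt_three]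
    nlinarith
  have hlt : π ^ 2 * p ^ 3 / 6 < p := by nlinarith
  have hlimsup := limsup_sum_Sband_shalf_sq_le hp0.le hp1'
  exact ⟨fun n hn h3 => ⟨sum_shalf_sq hn (by omega), shalf_eq hn⟩,
    tendsto_card_Sband_div hp0.le hp1',
    fun n hn h3 => sum_Sband_shalf_sq hn (two_mul_mfloor_lt hp0.le hp1' (by omega)),
    hlimsup, hlt, fun h => (hlimsup.trans_lt hlt).ne h.limsup_eq⟩
end

section
/- Fix integers 1 ≤ a_1 < a_2 and let (n_i) be a strictly increasing sequence of primes with a_2 < n_i/2 for all i, giving the sequence of 4-regular circulant graphs C_{n_i}(a_1, a_2). Then there is no sequence (B_{n_i}) where each B_{n_i} is an orthonormal basis of ℝ^{n_i} consisting of real eigenvectors of A(C_{n_i}(a_1, a_2)), such that for every p ∈ (0,1), every sequence of vertex subsets S_{n_i} ⊆ {0,...,n_i - 1} with |S_{n_i}|/n_i → p, and every sequence of eigenvectors φ_{n_i} ∈ B_{n_i}, one has μ_{φ_{n_i}}(S_{n_i}) → p. That is, for every such sequence of real orthonormal eigenbases there exist p ∈ (0,1), subsets S_{n_i} with |S_{n_i}|/n_i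 → p, and eigenvectors φ_{n_i} ∈ B_{n_i} with μ_{φ_{n_i}}(S_{n_i}) ↛ p. -/
open scoped Real

/-- The vertices `0, …, n - 1` identified with the residues modulo `n`. -/
def finEquivZMod (n : ℕ) [NeZero n] : Fin n ≃ ZMod n where
  toFun i := ((i : ℕ) : ZMod n)
  invFun z := ⟨z.val, z.val_lt⟩
  left_inv i := Fin.ext (ZMod.val_natCast_of_lt i.isLt)
  right_inv z := ZMod.natCast_zmod_val z

lemma natCast_zmod_ne_zero {n b : ℕ} (hb : 0 < b) (hbn : b < n) : (b : ZMod n) ≠ 0 := by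
  rw [Ne, ZMod.natCast_eq_zero_iff]
  exact Nat.not_dvd_of_pos_of_lt hb hbn

lemma circAdj_mulVec {n a1 a2 : ℕ} [NeZero n] (h1 : 1 ≤ a1) (h12 : a1 < a2) (hn : 2 * a2 < n)
    (f : ZMod n → ℝ) (i : Fin n) :
    (circAdj n 2 ![a1, a2]).mulVec (f ∘ finEquivZMod n) i =
      f (finEquivZMod n i - a1) + f (finEquivZMod n i + a1) +
        f (finEquivZMod n i - a2) + f (finEquivZMod n i + a2) := by
  have e1 : (a1 : ZMod n) ≠ -a1 := fun h => natCast_zmod_ne_zero (n := n) (b := a1 + a1)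
    (by omega) (by omega) (by push_cast; linear_combination h)
  have e2 : (a2 : ZMod n) ≠ -a2 := fun h => natCast_zmod_ne_zero (n := n) (b := a2 + a2)
    (by omega) (by omega) (by push_cast; linear_combination h)
  have e3 : (a1 : ZMod n) ≠ -a2 := fun h => natCast_zmod_ne_zero (n := n) (b := a1 + a2)
    (by omega) (by omega) (by push_cast; linear_combination h)
  have e4 : (a2 : ZMod n) ≠ a1 := fun h => natCast_zmod_ne_zero (n := n) (b := a2 - a1)
    (by omega) (by omega) (by rw [Nat.cast_sub h12.le]; linear_combination h)
  have key : ∀ z x : ZMod n,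
      (if ∃ k : Fin 2, x - z = ((![a1, a2] k : ℕ) : ZMod n) ∨
        x - z = -((![a1, a2] k : ℕ) : ZMod n) then (1 : ℝ) else 0) * f z =
      (if z = x - a1 then f z else 0) + (if z = x + a1 then f z else 0) +
      (if z = x - a2 then f z else 0) + (if z = x + a2 then f z else 0) := by
    intro z x
    have t1 : z = x - a1 ↔ x - z = a1 := by
      constructor <;> intro h <;> linear_combination -h
    have t2 : z = x + a1 ↔ x - z = -a1 := by
      constructor <;> intro h <;> linear_combination -h
    have t3 : z = x - a2 ↔ x - z = a2 := by
      constructor <;> intro h <;> linear_combination -h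
    have t4 : z = x + a2 ↔ x - z = -a2 := by
      constructor <;> intro h <;> linear_combination -h
    simp only [t1, t2, t3, t4, Fin.exists_fin_two, Matrix.cons_val_zero, Matrix.cons_val_one]
    generalize x - z = d
    by_cases d1 : d = a1
    · subst d1
      simp [e1, e3, e4.symm]
    by_cases d2 : d = -a1
    · subst d2
      simp [e1.symm, e4.symm, neg_eq_iff_eq_neg, e3]
    by_cases d3 : d = a2
    · subst d3
      simp [d1, d2, e2]
    by_cases d4 : d = -a2
    · subst d4
      simp [d1, d2, e2.symm]
    simp [d1, d2, d3, d4]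
  calc (circAdj n 2 ![a1, a2]).mulVec (f ∘ finEquivZMod n) i
      = ∑ z : ZMod n, (if ∃ k : Fin 2, finEquivZMod n i - z = ((![a1, a2] k : ℕ) : ZMod n) ∨
        finEquivZMod n i - z = -((![a1, a2] k : ℕ) : ZMod n) then (1 : ℝ) else 0) * f z :=
        (finEquivZMod n).sum_comp (fun z =>
          (if ∃ k : Fin 2, finEquivZMod n i - z = ((![a1, a2] k : ℕ) : ZMod n) ∨
          finEquivZMod n i - z = -((![a1, a2] k : ℕ) : ZMod n) then (1 : ℝ) else 0) * f z)
    _ = _ := by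
        simp_rw [key]
        simp [Finset.sum_add_distrib]

lemma circAdj_isSymm (n m : ℕ) (a : Fin m → ℕ) : (circAdj n m a).IsSymm := by
  ext i j
  simp only [circAdj, Matrix.transpose_apply, Matrix.of_apply]
  congr 1
  refine propext (exists_congr fun k => ?_)
  rw [← neg_sub ((i : ℕ) : ZMod n), neg_eq_iff_eq_neg, neg_inj, or_comm]

/-- The half of the index set carrying the largest values of `f` detects the `ℓ¹` distance of `f`
to its mean. -/
lemma exists_half_sum_ge {ι : Type*} [Fintype ι] [DecidableEq ι] (f : ι → ℝ)
    (hf : ∑ x, f x = 0) (hι : 2 ≤ Fintype.card ι) :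
    ∃ S : Finset ι, S.card = Fintype.card ι / 2 ∧ ∑ x, |f x| ≤ 6 * ∑ x ∈ S, f x := by
  set n := Fintype.card ι with hn
  obtain ⟨S, hS, hmax⟩ := Finset.exists_max_image (Finset.powersetCard (n / 2) Finset.univ)
    (fun S : Finset ι => ∑ x ∈ S, f x)
    (Finset.powersetCard_nonempty.2 (by rw [Finset.card_univ]; omega))
  have hcard : S.card = n / 2 := (Finset.mem_powersetCard.1 hS).2
  refine ⟨S, hcard, ?_⟩
  have hle : ∀ x ∈ S, ∀ y ∉ S, f y ≤ f x := by
    intro x hx y hy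
    have hy' : y ∉ S.erase x := fun h => hy (Finset.mem_of_mem_erase h)
    have hs := hmax (insert y (S.erase x)) (Finset.mem_powersetCard.2 ⟨Finset.subset_univ _, by
      rw [Finset.card_insert_of_notMem hy', Finset.card_erase_of_mem hx]
      omega⟩)
    simp only [Finset.sum_insert hy'] at hs
    have := Finset.add_sum_erase S f hx
    linarith
  obtain ⟨x₀, hx₀, hmin⟩ := S.exists_min_image f (Finset.card_pos.1 (by omega))
  set m := f x₀
  set s := ∑ x ∈ S, f x
  have hk : (1 : ℝ) ≤ S.card := by
    exact_mod_cast (show 1 ≤ S.card by omega)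
  have hsum : s + ∑ x ∈ Sᶜ, f x = 0 := by rw [Finset.sum_add_sum_compl, hf]
  have hin : ∑ x ∈ S, |f x - m| = s - S.card * m := by
    rw [Finset.sum_congr rfl fun x hx => abs_of_nonneg (sub_nonneg.2 (hmin x hx))]
    simp [Finset.sum_sub_distrib, s]
  have hout : ∑ x ∈ Sᶜ, |f x - m| = Sᶜ.card * m - ∑ x ∈ Sᶜ, f x := by
    rw [Finset.sum_congr rfl fun x hx => abs_of_nonpos
      (sub_nonpos.2 (hle x₀ hx₀ x (Finset.mem_compl.1 hx)))]
    simp [Finset.sum_sub_distrib, m]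
  have hcc : (S.card : ℝ) + Sᶜ.card = n := by exact_mod_cast S.card_add_card_compl
  have hc0 : S.card ≤ Sᶜ.card ∧ Sᶜ.card ≤ S.card + 1 := by
    have := S.card_add_card_compl
    omega
  have hc1 : (S.card : ℝ) ≤ Sᶜ.card := by exact_mod_cast hc0.1
  have hc2 : (Sᶜ.card : ℝ) ≤ S.card + 1 := by exact_mod_cast hc0.2
  have hin0 : 0 ≤ ∑ x ∈ S, |f x - m| := Finset.sum_nonneg fun _ _ => abs_nonneg _
  have hout0 : 0 ≤ ∑ x ∈ Sᶜ, |f x - m| := Finset.sum_nonneg fun _ _ => abs_nonneg _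
  have htot : ∑ x, |f x - m| ≤ 3 * s := by
    rw [← Finset.sum_add_sum_compl S, hin, hout]
    rcases le_total m 0 with hm | hm
    · nlinarith
    · nlinarith
  have hnm : n * |m| ≤ ∑ x, |f x - m| := by
    calc (n : ℝ) * |m| = |∑ x, (f x - m)| := by
          rw [Finset.sum_sub_distrib, hf]
          simp [abs_mul, hn]
      _ ≤ _ := Finset.abs_sum_le_sum_abs _ _
  calc ∑ x, |f x| ≤ ∑ x, (|f x - m| + |m|) :=
        Finset.sum_le_sum fun x _ => by simpa using abs_add_le (f x - m) m
    _ = ∑ x, |f x - m| + n * |m| := by simp [Finset.sum_add_distrib, hn]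
    _ ≤ 6 * s := by linarith

/-- An eigenvector of a four-term convolution operator whose eigenvalue is far from the even
integers is not close to a vector with entries `±1/√n`. -/
lemma sum_abs_sq_sub_ge {n : ℕ} [NeZero n] (a b : ZMod n) (f : ZMod n → ℝ) (μ : ℝ)
    (hμ : 5 / 2 ≤ μ ∧ μ ≤ 7 / 2)
    (heig : ∀ x, f (x - a) + f (x + a) + f (x - b) + f (x + b) = μ * f x) :
    1 / 325 ≤ ∑ x, |f x ^ 2 - 1 / n| := by
  have hn : (0 : ℝ) < n := by exact_mod_cast NeZero.pos n
  set r : ℝ := √(1 / n)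
  have hr : r ^ 2 = 1 / n := Real.sq_sqrt (by positivity)
  have hr0 : 0 ≤ r := Real.sqrt_nonneg _
  set σ : ZMod n → ℝ := fun x => if 0 ≤ f x then 1 else -1 with hσ
  have hσ' : ∀ x, σ x = 1 ∨ σ x = -1 := fun x => by
    by_cases h : 0 ≤ f x <;> simp [hσ, h]
  set d : ZMod n → ℝ := fun x => f x - σ x * r with hd
  have hd2 : ∀ x, d x ^ 2 ≤ |f x ^ 2 - 1 / n| := by
    intro x
    rw [← hr]
    by_cases h : 0 ≤ f x
    · have : d x = f x - r := by simp [hd, hσ, h]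
      rw [this, show f x ^ 2 - r ^ 2 = (f x - r) * (f x + r) by ring, abs_mul, ← sq_abs, sq]
      refine mul_le_mul_of_nonneg_left ?_ (abs_nonneg _)
      rw [abs_of_nonneg (add_nonneg h hr0)]
      exact abs_le.2 ⟨by linarith, by linarith⟩
    · have : d x = f x + r := by simp [hd, hσ, h]
      push Not at h
      rw [this, show f x ^ 2 - r ^ 2 = (f x + r) * (f x - r) by ring, abs_mul, ← sq_abs, sq]
      refine mul_le_mul_of_nonneg_left ?_ (abs_nonneg _)
      rw [abs_of_nonpos (by linarith : f x - r ≤ 0)]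
      exact abs_le.2 ⟨by linarith, by linarith⟩
  have hpt : ∀ x, 1 / 4 * (1 / n : ℝ) ≤
      65 / 4 * (d x ^ 2 + d (x - a) ^ 2 + d (x + a) ^ 2 + d (x - b) ^ 2 + d (x + b) ^ 2) := by
    intro x
    have hrel : d (x - a) + d (x + a) + d (x - b) + d (x + b) - μ * d x =
        (μ * σ x - (σ (x - a) + σ (x + a) + σ (x - b) + σ (x + b))) * r := by
      linear_combination heig x
    have hlow : 1 / 4 ≤ (μ * σ x - (σ (x - a) + σ (x + a) + σ (x - b) + σ (x + b))) ^ 2 := by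
      have habs : 1 / 2 ≤ μ * σ x - (σ (x - a) + σ (x + a) + σ (x - b) + σ (x + b)) ∨
          μ * σ x - (σ (x - a) + σ (x + a) + σ (x - b) + σ (x + b)) ≤ -(1 / 2) := by
        rcases hσ' x with h0 | h0 <;> rcases hσ' (x - a) with h1 | h1 <;>
          rcases hσ' (x + a) with h2 | h2 <;> rcases hσ' (x - b) with h3 | h3 <;>
          rcases hσ' (x + b) with h4 | h4 <;> rw [h0, h1, h2, h3, h4] <;>
          first
            | exact Or.inl (by linarith)
            | exact Or.inr (by linarith)
      rcases habs with h | h <;> nlinarith only [h]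
    have hup : ∀ u v w y z : ℝ, (v + w + y + z - μ * u) ^ 2 ≤
        65 / 4 * (u ^ 2 + v ^ 2 + w ^ 2 + y ^ 2 + z ^ 2) := by
      intro u v w y z
      have hcs : (v + w + y + z - μ * u) ^ 2 ≤
          (μ ^ 2 + 4) * (u ^ 2 + v ^ 2 + w ^ 2 + y ^ 2 + z ^ 2) := by
        linarith [sq_nonneg (v - w), sq_nonneg (v - y), sq_nonneg (v - z), sq_nonneg (w - y),
          sq_nonneg (w - z), sq_nonneg (y - z), sq_nonneg (u + μ * v), sq_nonneg (u + μ * w),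
          sq_nonneg (u + μ * y), sq_nonneg (u + μ * z)]
      refine hcs.trans (mul_le_mul_of_nonneg_right (by nlinarith) (by positivity))
    calc 1 / 4 * (1 / n : ℝ) ≤
        (μ * σ x - (σ (x - a) + σ (x + a) + σ (x - b) + σ (x + b))) ^ 2 * r ^ 2 := by
          rw [hr]
          exact mul_le_mul_of_nonneg_right hlow (by positivity)
      _ ≤ _ := by
          rw [← mul_pow, ← hrel]
          exact hup _ _ _ _ _
  have hsum := Finset.sum_le_sum fun x (_ : x ∈ Finset.univ) => hpt x
  have s1 : ∀ c, ∑ x, d (x - c) ^ 2 = ∑ x, d x ^ 2 := fun c =>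
    Equiv.sum_comp (Equiv.subRight c) (fun x => d x ^ 2)
  have s2 : ∀ c, ∑ x, d (x + c) ^ 2 = ∑ x, d x ^ 2 := fun c =>
    Equiv.sum_comp (Equiv.addRight c) (fun x => d x ^ 2)
  have hone : ∑ _x : ZMod n, 1 / 4 * (1 / n : ℝ) = 1 / 4 := by
    simp [ZMod.card]
    field_simp
  rw [hone, ← Finset.mul_sum] at hsum
  simp only [Finset.sum_add_distrib, s1, s2] at hsum
  have := Finset.sum_le_sum fun x (_ : x ∈ Finset.univ) => hd2 x
  linarith

lemma exists_half_measure_ge {n a1 a2 : ℕ} (h1 : 1 ≤ a1) (h12 : a1 < a2) (hn : 2 * a2 < n)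
    (φ : Fin n → ℝ) (hφ : ∑ v, φ v * φ v = 1) (μ : ℝ) (hμ : 5 / 2 ≤ μ ∧ μ ≤ 7 / 2)
    (heig : (circAdj n 2 ![a1, a2]).mulVec φ = μ • φ) :
    ∃ S : Finset (Fin n), S.card = n / 2 ∧
      ((n / 2 : ℕ) : ℝ) / n + 1 / 1950 ≤ ∑ v ∈ S, φ v ^ 2 := by
  have : NeZero n := ⟨by omega⟩
  have hn0 : (n : ℝ) ≠ 0 := by exact_mod_cast NeZero.ne n
  have hge := sum_abs_sq_sub_ge (a1 : ZMod n) a2 (φ ∘ (finEquivZMod n).symm) μ hμ (by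
    intro x
    obtain ⟨i, rfl⟩ := (finEquivZMod n).surjective x
    rw [← circAdj_mulVec h1 h12 hn]
    simp [Function.comp_assoc, heig])
  have htrans : ∑ x, |(φ ∘ (finEquivZMod n).symm) x ^ 2 - 1 / n| = ∑ v, |φ v ^ 2 - 1 / n| :=
    (finEquivZMod n).symm.sum_comp (fun v => |φ v ^ 2 - 1 / n|)
  obtain ⟨S, hS, hsum⟩ := exists_half_sum_ge (fun v => φ v ^ 2 - 1 / n) (by
    simp only [Finset.sum_sub_distrib, pow_two, hφ]
    simp [hn0]) (by simp; omega)
  rw [Fintype.card_fin] at hS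
  refine ⟨S, hS, ?_⟩
  rw [Finset.sum_sub_distrib, Finset.sum_const, hS, nsmul_eq_mul] at hsum
  rw [htrans] at hge
  have : ((n / 2 : ℕ) : ℝ) * (1 / n) = ((n / 2 : ℕ) : ℝ) / n := by ring
  linarith

lemma circAdj_mulVec_cos {n a1 a2 : ℕ} [NeZero n] (h1 : 1 ≤ a1) (h12 : a1 < a2) (hn : 2 * a2 < n)
    (j : ℕ) :
    (circAdj n 2 ![a1, a2]).mulVec (fun v => (ZMod.stdAddChar ((j : ZMod n) * finEquivZMod n v)).re) =
      (2 * Real.cos (a1 * (2 * π * j / n)) + 2 * Real.cos (a2 * (2 * π * j / n))) •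
        (fun v : Fin n => (ZMod.stdAddChar ((j : ZMod n) * finEquivZMod n v)).re) := by
  have hcos : ∀ b : ℕ, (ZMod.stdAddChar ((j : ZMod n) * (b : ZMod n))).re =
      Real.cos (b * (2 * π * j / n)) := by
    intro b
    have := ZMod.stdAddChar_coe (N := n) ((j * b : ℕ) : ℤ)
    push_cast at this
    rw [this, ← Complex.exp_ofReal_mul_I_re]
    congr 2
    push_cast
    ring
  have hadd : ∀ y z : ZMod n, (ZMod.stdAddChar (y - z)).re + (ZMod.stdAddChar (y + z)).re =
      2 * (ZMod.stdAddChar z).re * (ZMod.stdAddChar y).re := by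
    intro y z
    rw [sub_eq_add_neg, AddChar.map_add_eq_mul, AddChar.map_add_eq_mul,
      AddChar.map_neg_eq_conj]
    simp
    ring
  ext i
  rw [show (fun v : Fin n => (ZMod.stdAddChar ((j : ZMod n) * finEquivZMod n v)).re) =
    (fun z => (ZMod.stdAddChar ((j : ZMod n) * z)).re) ∘ finEquivZMod n from rfl,
    circAdj_mulVec h1 h12 hn]
  simp only [mul_sub, mul_add, Pi.smul_apply, smul_eq_mul, Function.comp_apply]
  have ha := hadd (j * finEquivZMod n i) (j * a1)
  have hb := hadd (j * finEquivZMod n i) (j * a2)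
  rw [hcos] at ha hb
  linear_combination ha + hb

/-- Every eigenvalue of a symmetric matrix occurs in every orthonormal eigenbasis. -/
lemma exists_basis_eigenvector {n : ℕ} {A : Matrix (Fin n) (Fin n) ℝ} (hA : A.IsSymm)
    {B : Fin n → Fin n → ℝ} (horth : ∀ j k, ∑ v, B j v * B k v = if j = k then 1 else 0)
    (heig : ∀ j, ∃ μ : ℝ, A.mulVec (B j) = μ • B j) {w : Fin n → ℝ} (hw : w ≠ 0) {μ : ℝ}
    (hAw : A.mulVec w = μ • w) : ∃ j, A.mulVec (B j) = μ • B j := by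
  have hB : Matrix.of B * (Matrix.of B).transpose = 1 := by
    ext j k
    simp [Matrix.mul_apply, horth, Matrix.one_apply]
  have hB' := _root_.mul_eq_one_comm.1 hB
  obtain ⟨j, hj⟩ : ∃ j, B j ⬝ᵥ w ≠ 0 := by
    by_contra! h
    refine hw ?_
    have h0 : (Matrix.of B).mulVec w = 0 := funext h
    rw [← Matrix.one_mulVec w, ← hB', ← Matrix.mulVec_mulVec, h0, Matrix.mulVec_zero]
  obtain ⟨ν, hν⟩ := heig j
  have hsymm : A.mulVec (B j) ⬝ᵥ w = B j ⬝ᵥ A.mulVec w := by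
    rw [Matrix.dotProduct_mulVec, ← Matrix.mulVec_transpose, hA.eq]
  rw [hν, hAw, smul_dotProduct, dotProduct_smul, smul_eq_mul, smul_eq_mul] at hsymm
  exact ⟨j, by rw [hν, mul_right_cancel₀ hj hsymm]⟩

lemma exists_cos_add_cos_eq_three {a1 a2 : ℕ} (h2 : 0 < a2) :
    ∃ θ : ℝ, 0 ≤ θ ∧ 2 * Real.cos (a1 * θ) + 2 * Real.cos (a2 * θ) = 3 := by
  have h2' : (0 : ℝ) < a2 := by exact_mod_cast h2
  have hb : (0 : ℝ) ≤ π / 2 / a2 := by positivity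
  obtain ⟨θ, hθ, h⟩ := intermediate_value_Icc' (f := fun θ : ℝ =>
    2 * Real.cos (a1 * θ) + 2 * Real.cos (a2 * θ)) hb (by fun_prop) (show (3 : ℝ) ∈ _ by
      simp only [mul_div_cancel₀ _ h2'.ne', Real.cos_pi_div_two, mul_zero, Real.cos_zero]
      have := Real.cos_le_one (a1 * (π / 2 / a2))
      exact ⟨by linarith, by norm_num⟩)
  exact ⟨θ, hθ.1, h⟩

lemma tendsto_two_pi_floor_div {θ : ℝ} (hθ : 0 ≤ θ) :
    Filter.Tendsto (fun n : ℕ => 2 * π * (⌊θ / (2 * π) * n⌋₊ : ℝ) / n) Filter.atTop (nhds θ) := by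
  have h := ((tendsto_nat_floor_mul_div_atTop (R := ℝ) (a := θ / (2 * π)) (by positivity)).comp
    tendsto_natCast_atTop_atTop).const_mul (2 * π)
  rw [mul_div_cancel₀ _ (by positivity : 2 * π ≠ 0)] at h
  exact h.congr fun n => by simp [mul_div_assoc]

theorem statement14 (a1 a2 : ℕ) (h1 : 1 ≤ a1) (h12 : a1 < a2)
    -- a strictly increasing sequence of primes `n_i` with `a_2 < n_i / 2`
    (n : ℕ → ℕ) (hmono : StrictMono n) (hprime : ∀ i, (n i).Prime)
    (hhalf : ∀ i, 2 * a2 < n i)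
    -- `B i` is an orthonormal basis of ℝ^{n_i} (being `n_i` orthonormal vectors)
    (B : ∀ i, Fin (n i) → (Fin (n i) → ℝ))
    (horth : ∀ i, ∀ j k : Fin (n i),
      ∑ v, B i j v * B i k v = if j = k then 1 else 0)
    -- consisting of real eigenvectors of `A(C_{n_i}(a_1, a_2))`
    (heig : ∀ i, ∀ j : Fin (n i), ∃ μ : ℝ,
      (circAdj (n i) 2 ![a1, a2]).mulVec (B i j) = μ • B i j) :
    -- then there exist `p ∈ (0,1)`, vertex subsets `S_{n_i}` with
    -- `|S_{n_i}|/n_i → p`, and eigenvectors `φ_{n_i} ∈ B_{n_i}` such that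
    -- `μ_{φ_{n_i}}(S_{n_i})` does not converge to `p`.
    ∃ p : ℝ, 0 < p ∧ p < 1 ∧
      ∃ S : ∀ i, Finset (Fin (n i)),
        Filter.Tendsto (fun i => ((S i).card : ℝ) / (n i)) Filter.atTop (nhds p) ∧
        ∃ φ : ∀ i, Fin (n i),
          ¬ Filter.Tendsto (fun i => ∑ v ∈ S i, (B i (φ i) v) ^ 2)
              Filter.atTop (nhds p) := by
  have hnpos : ∀ i, NeZero (n i) := fun i => ⟨(hprime i).ne_zero⟩
  obtain ⟨θ, hθ0, hθ⟩ := exists_cos_add_cos_eq_three (a1 := a1) (a2 := a2) (by omega)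
  have hev : ∀ᶠ i in Filter.atTop, ∃ j : Fin (n i), ∃ μ : ℝ, (5 / 2 ≤ μ ∧ μ ≤ 7 / 2) ∧
      (circAdj (n i) 2 ![a1, a2]).mulVec (B i j) = μ • B i j := by
    have hcont : Continuous fun t : ℝ => 2 * Real.cos (a1 * t) + 2 * Real.cos (a2 * t) := by
      fun_prop
    have hlim := ((hcont.tendsto θ).comp (tendsto_two_pi_floor_div hθ0)).comp hmono.tendsto_atTop
    rw [hθ] at hlim
    filter_upwards [hlim.eventually (Icc_mem_nhds (a := 5 / 2) (b := 7 / 2) (by norm_num)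
      (by norm_num))] with i hi
    obtain ⟨j, hj⟩ := exists_basis_eigenvector (circAdj_isSymm _ _ _) (horth i) (heig i)
      (fun h => by simpa [finEquivZMod] using congrFun h 0)
      (circAdj_mulVec_cos h1 h12 (hhalf i) ⌊θ / (2 * π) * n i⌋₊)
    exact ⟨j, _, hi, hj⟩
  have hchoice : ∀ i, ∃ S : Finset (Fin (n i)), ∃ j : Fin (n i), S.card = n i / 2 ∧
      ((∃ j : Fin (n i), ∃ μ : ℝ, (5 / 2 ≤ μ ∧ μ ≤ 7 / 2) ∧
        (circAdj (n i) 2 ![a1, a2]).mulVec (B i j) = μ • B i j) →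
        ((n i / 2 : ℕ) : ℝ) / n i + 1 / 1950 ≤ ∑ v ∈ S, B i j v ^ 2) := by
    intro i
    by_cases h : ∃ j : Fin (n i), ∃ μ : ℝ, (5 / 2 ≤ μ ∧ μ ≤ 7 / 2) ∧
      (circAdj (n i) 2 ![a1, a2]).mulVec (B i j) = μ • B i j
    · obtain ⟨j, μ, hμ, hj⟩ := h
      obtain ⟨S, hS, hle⟩ := exists_half_measure_ge h1 h12 (hhalf i) (B i j)
        (by simpa using horth i j j) μ hμ hj
      exact ⟨S, j, hS, fun _ => hle⟩
    · obtain ⟨S, -, hS⟩ := Finset.exists_subset_card_eq (s := (Finset.univ : Finset (Fin (n i))))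
        (n := n i / 2) (by rw [Finset.card_fin]; omega)
      exact ⟨S, 0, hS, fun h' => absurd h' h⟩
  choose S φ hS hφ using hchoice
  have hdens : Filter.Tendsto (fun i => ((S i).card : ℝ) / n i) Filter.atTop (nhds (1 / 2)) := by
    have h := ((tendsto_nat_floor_mul_div_atTop (R := ℝ) (a := 1 / 2) (by norm_num)).comp
      tendsto_natCast_atTop_atTop).comp hmono.tendsto_atTop
    refine h.congr fun i => ?_
    have hfloor : ⌊(1 / 2 : ℝ) * n i⌋₊ = n i / 2 := by
      rw [one_div_mul_eq_div]
      exact_mod_cast Nat.floor_div_eq_div (K := ℝ) (n i) 2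
    simp only [Function.comp_apply, hfloor, hS]
  refine ⟨1 / 2, by norm_num, by norm_num, S, hdens, φ, fun hlim => ?_⟩
  have hle := le_of_tendsto_of_tendsto (hdens.add_const (1 / 1950)) hlim
    (hev.mono fun i hi => by simpa only [hS] using hφ i hi)
  norm_num at hle
end
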